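/- Let P > 1, let g : ℤ → ℝ satisfy g ∈ ℓ¹ with connected infinite support on which it is strictly positive and strictly decreasing, let u ∈ ℓ∞(P) satisfy S_c⁻(Δ_c u^P) = 2 and S_c⁺(u^P) = 2, and define o^P = −H_{ḡ^P} sign(u^P). If P_p(u^P) = P_p(o^P) and P_n(u^P) = P_n(o^P), then P_p(u^P) = P_n(u^P). If additionally u^P has no zero entries, then P = 2 P_p(u^P). -/

import Mathlib

open scoped BigOperators

/-- Number of sign changes in a list of reals after deleting zero entries;
`-1` if all entries are zero. -/
noncomputable def signChangesList (l : List ℝ) : ℤ :=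
  let nz := l.filter (fun x => decide (x ≠ 0))
  if nz.isEmpty then -1
  else ((nz.zip nz.tail).countP (fun p => decide (p.1 * p.2 < 0)) : ℤ)

/-- `S⁻(v)`: number of sign changes of `v` after deleting zeros (`-1` for `v = 0`). -/
noncomputable def Sminus {n : ℕ} (v : Fin n → ℝ) : ℤ :=
  signChangesList (List.ofFn v)

/-- `w` is obtained from `v` by replacing (some of the) zero entries by arbitrary reals. -/
def FillsZeros {n : ℕ} (v w : Fin n → ℝ) : Prop := ∀ i, v i ≠ 0 → w i = v i

/-- `S⁺(v)`: maximum of `S⁻` over all fillings of the zero entries of `v`. -/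
noncomputable def Splus {n : ℕ} (v : Fin n → ℝ) : ℤ :=
  sSup {z : ℤ | ∃ w : Fin n → ℝ, FillsZeros v w ∧ z = Sminus w}

/-- the rotated list `[v i, v (i+1), …, v (i+n-1), v i]`. -/
noncomputable def cycList {n : ℕ} (v : Fin n → ℝ) (i : Fin n) : List ℝ :=
  (List.ofFn fun j : Fin n => v (i + j)) ++ [v i]

/-- cyclic variation `S_c⁻(v)`: the supremum of `S⁻` over all cyclic rotations
`[v_i, …, v_n, v_1, …, v_i]` of `v`. -/
noncomputable def Scminus {n : ℕ} (v : Fin n → ℝ) : ℤ :=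
  sSup {z : ℤ | ∃ i : Fin n, z = signChangesList (cycList v i)}

/-- cyclic variation `S_c⁺(v)`: the supremum of `S_c⁻` over all fillings of the
zero entries of `v`. -/
noncomputable def Scplus {n : ℕ} (v : Fin n → ℝ) : ℤ :=
  sSup {z : ℤ | ∃ w : Fin n → ℝ, FillsZeros v w ∧ z = Scminus w}

/-- cyclic successor index `i + 1 (mod n)`. -/
def cnext {n : ℕ} (i : Fin n) : Fin n :=
  ⟨(i.val + 1) % n, Nat.mod_lt _ (Nat.lt_of_le_of_lt (Nat.zero_le _) i.isLt)⟩

/-- cyclic predecessor index `i - 1 (mod n)`. -/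
def cprev {n : ℕ} (i : Fin n) : Fin n :=
  ⟨(i.val + (n - 1)) % n, Nat.mod_lt _ (Nat.lt_of_le_of_lt (Nat.zero_le _) i.isLt)⟩

/-- cyclic forward difference `(Δ_c v)_i = v_{i+1 (mod n)} - v_i`. -/
noncomputable def cdiff {n : ℕ} (v : Fin n → ℝ) : Fin n → ℝ :=
  fun i => v (cnext i) - v i

/-- number of positive entries. -/
noncomputable def Pp {n : ℕ} (v : Fin n → ℝ) : ℕ :=
  (Finset.univ.filter fun i => 0 < v i).card

/-- number of negative entries. -/
noncomputable def Pn {n : ℕ} (v : Fin n → ℝ) : ℕ :=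
  (Finset.univ.filter fun i => v i < 0).card

/-- one period of the `P`-periodic summation `ḡ(t) = ∑_{k ∈ ℤ} g(t + kP)`. -/
noncomputable def pbar (g : ℤ → ℝ) (P : ℕ) : Fin P → ℝ :=
  fun i => ∑' k : ℤ, g (((i : ℕ) : ℤ) + k * (P : ℤ))

/-- convolution `(g ∗ u)(t) = ∑_{τ ∈ ℤ} g(t - τ) u(τ)`. -/
noncomputable def conv (g u : ℤ → ℝ) : ℤ → ℝ :=
  fun t => ∑' τ : ℤ, g (t - τ) * u τ

/-- the cyclic back-shift matrix `Q_P`, mapping `e_j` to `e_{j+1 (mod P)}`. -/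
def Qmat (P : ℕ) : Matrix (Fin P) (Fin P) ℝ :=
  Matrix.of fun i j => if (i : ℕ) = ((j : ℕ) + 1) % P then 1 else 0

/-- number of adjacent strict sign changes. -/
noncomputable def adjChanges (l : List ℝ) : ℕ :=
  (l.zip l.tail).countP (fun p => decide (p.1 * p.2 < 0))

lemma adjChanges_cons_cons (x y : ℝ) (l : List ℝ) :
    adjChanges (x :: y :: l) = adjChanges (y :: l) + (if x * y < 0 then 1 else 0) := by
  simp [adjChanges, List.countP_cons]

lemma adjChanges_single (x : ℝ) : adjChanges [x] = 0 := by simp [adjChanges]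

lemma adjChanges_swap (x y : ℝ) (hy : y ≠ 0) (l : List ℝ) :
    adjChanges (x :: l) ≤ adjChanges (y :: l) + (if x * y < 0 then 1 else 0) := by
  cases l with
  | nil => simp [adjChanges_single]
  | cons z l =>
    rw [adjChanges_cons_cons, adjChanges_cons_cons]
    have : (if x * z < 0 then 1 else 0) ≤ (if y * z < 0 then 1 else 0) +
        (if x * y < 0 then 1 else (0 : ℕ)) := by
      by_cases h1 : x * z < 0
      · by_cases h2 : y * z < 0
        · simp [h1, h2]
        · have h3 : x * y < 0 := by
            rcases lt_or_gt_of_ne hy with h | h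
            · rcases mul_neg_iff.1 h1 with ⟨a, b⟩ | ⟨a, b⟩
              · nlinarith
              · exfalso; apply h2; nlinarith
            · rcases mul_neg_iff.1 h1 with ⟨a, b⟩ | ⟨a, b⟩
              · exfalso; apply h2; nlinarith
              · nlinarith
          simp [h1, h3]
      · simp [h1]
    omega

lemma adjChanges_mono {l₁ l₂ : List ℝ} (h : List.Sublist l₁ l₂) (hn : ∀ x ∈ l₂, x ≠ 0) (x : ℝ) :
    adjChanges (x :: l₁) ≤ adjChanges (x :: l₂) := by
  induction h generalizing x with
  | slnil => exact le_rfl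
  | cons y h ih =>
    have hy : y ≠ 0 := hn y (by simp)
    have := ih (fun z hz => hn z (by simp [hz])) y
    have h2 := adjChanges_swap x y hy
    rw [adjChanges_cons_cons]
    exact (h2 _).trans (by omega)
  | cons_cons y h ih =>
    have := ih (fun z hz => hn z (by simp [hz])) y
    rw [adjChanges_cons_cons, adjChanges_cons_cons]
    omega

lemma four_le_signChangesList {l : List ℝ} {a b c d e : ℝ}
    (ha : 0 < a) (hb : b < 0) (hc : 0 < c) (hd : d < 0) (he : 0 < e)
    (h : List.Sublist [a, b, c, d, e] l) : 4 ≤ signChangesList l := by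
  have h1 := h.filter (fun x => decide (x ≠ 0))
  rw [List.filter_eq_self.2] at h1
  · unfold signChangesList
    have hne : (l.filter (fun x => decide (x ≠ 0))) ≠ [] := by
      intro h0
      rw [h0] at h1
      simp at h1
    have h3 := adjChanges_mono h1 (by intro x hx; simpa using (List.mem_filter.1 hx).2) 0
    have h4 : adjChanges (0 :: l.filter (fun x => decide (x ≠ 0)))
        = adjChanges (l.filter (fun x => decide (x ≠ 0))) := by
      cases hl : l.filter (fun x => decide (x ≠ 0)) with
      | nil => exact absurd hl hne
      | cons y t => rw [adjChanges_cons_cons]; simp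
    rw [h4] at h3
    have h5 : adjChanges [0, a, b, c, d, e] = 4 := by
      simp only [adjChanges_cons_cons, adjChanges_single]
      have e1 : a * b < 0 := by nlinarith
      have e2 : b * c < 0 := by nlinarith
      have e3 : c * d < 0 := by nlinarith
      have e4 : d * e < 0 := by nlinarith
      simp [e1, e2, e3, e4]
    rw [h5] at h3
    simp only [List.isEmpty_iff, hne, if_false]
    unfold adjChanges at h3
    exact_mod_cast h3
  · intro x hx
    simp at hx
    rcases hx with rfl | rfl | rfl | rfl | rfl <;> simp <;> linarith

lemma signChangesList_le (l : List ℝ) : signChangesList l ≤ l.length := by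
  unfold signChangesList
  simp only
  split_ifs
  · have : (0 : ℤ) ≤ l.length := by positivity
    omega
  · have h1 := List.countP_le_length (p := fun p : ℝ × ℝ => decide (p.1 * p.2 < 0))
      (l := (l.filter (fun x => decide (x ≠ 0))).zip (l.filter (fun x => decide (x ≠ 0))).tail)
    have h2 := List.length_filter_le (fun x : ℝ => decide (x ≠ 0)) l
    rw [List.length_zip] at h1
    exact_mod_cast h1.trans ((min_le_left _ _).trans h2)

lemma signChangesList_cycList_le {n : ℕ} (v : Fin n → ℝ) (i : Fin n) :
    signChangesList (cycList v i) ≤ n + 1 := by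
  refine (signChangesList_le _).trans ?_
  simp [cycList]

lemma le_Scminus {n : ℕ} (v : Fin n → ℝ) (i : Fin n) :
    signChangesList (cycList v i) ≤ Scminus v := by
  refine le_csSup ⟨n + 1, ?_⟩ ⟨i, rfl⟩
  rintro z ⟨j, rfl⟩
  exact signChangesList_cycList_le v j

lemma Scminus_le {n : ℕ} [NeZero n] (v : Fin n → ℝ) : Scminus v ≤ n + 1 := by
  refine csSup_le ⟨_, 0, rfl⟩ ?_
  rintro z ⟨j, rfl⟩
  exact signChangesList_cycList_le v j

lemma le_Scplus {n : ℕ} [NeZero n] (v w : Fin n → ℝ) (h : FillsZeros v w) :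
    Scminus w ≤ Scplus v := by
  refine le_csSup ⟨n + 1, ?_⟩ ⟨w, h, rfl⟩
  rintro z ⟨j, _, rfl⟩
  exact Scminus_le j

/-- No weak cyclic alternation in `Fin`. -/
lemma fin_noalt {n : ℕ} [NeZero n] (v : Fin n → ℝ) (h : Scplus v = 2) (i a b c : Fin n)
    (h0 : 0 < a) (hab : a < b) (hbc : b < c)
    (hi : 0 ≤ v i) (ha : v (i + a) ≤ 0) (hb : 0 ≤ v (i + b)) (hc : v (i + c) ≤ 0) : False := by
  classical
  set w : Fin n → ℝ := fun k => if v k ≠ 0 then v k else if k = i ∨ k = i + b then 1 else -1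
    with hw
  have hf : FillsZeros v w := fun k hk => by simp [hw, hk]
  have hwi : 0 < w i := by
    by_cases hz : v i = 0
    · simp [hw, hz]
    · simp only [hw, ne_eq, hz, not_false_eq_true, if_true]
      exact lt_of_le_of_ne hi (Ne.symm hz)
  have hwb : 0 < w (i + b) := by
    by_cases hz : v (i + b) = 0
    · simp [hw, hz]
    · simp only [hw, ne_eq, hz, not_false_eq_true, if_true]
      exact lt_of_le_of_ne hb (Ne.symm hz)
  have key : ∀ a : Fin n, a ≠ 0 → a ≠ b → v (i + a) ≤ 0 → w (i + a) < 0 := by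
    intro a h1 h2 h3
    by_cases hz : v (i + a) = 0
    · simp [hw, hz, h1, h2]
    · simp only [hw, ne_eq, hz, not_false_eq_true, if_true]
      exact lt_of_le_of_ne h3 hz
  have hwa := key a h0.ne' hab.ne ha
  have hwc := key c (h0.trans (hab.trans hbc)).ne' hbc.ne' hc
  have hsub : List.Sublist [0, a, b, c] (List.finRange n) := by
    apply List.sublist_of_subperm_of_pairwise (r := (· < ·))
    · apply List.Nodup.subperm
      · simp [h0.ne, hab.ne, hbc.ne, (h0.trans hab).ne, (hab.trans hbc).ne,
          (h0.trans (hab.trans hbc)).ne]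
      · intro x _; simp
    · simp [h0, hab, hbc, (h0.trans hab), (hab.trans hbc), (h0.trans (hab.trans hbc))]
    · exact List.pairwise_lt_finRange n
  have hsub2 : List.Sublist [w i, w (i + a), w (i + b), w (i + c), w i] (cycList w i) := by
    unfold cycList
    rw [List.ofFn_eq_map]
    have := (hsub.map (fun j => w (i + j))).append (List.Sublist.refl [w i])
    simpa using this
  have h4 := four_le_signChangesList hwi hwa hwb hwc hwi hsub2
  have := le_Scminus w i
  have := le_Scplus v w hf
  omega

lemma per_mul {u : ℤ → ℝ} {P : ℕ} (hper : ∀ t : ℤ, u (t + P) = u t) (t k : ℤ) :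
    u (t + k * P) = u t := by
  have h : Function.Periodic u (P : ℤ) := hper
  simpa using h.int_mul k t

lemma per_emod {u : ℤ → ℝ} {P : ℕ} (hper : ∀ t : ℤ, u (t + P) = u t) (t : ℤ) :
    u (t % P) = u t := by
  rw [← per_mul hper (t % P) (t / P)]
  congr 1
  rw [mul_comm]; exact Int.emod_add_mul_ediv t P

lemma per_fin_add {u : ℤ → ℝ} {P : ℕ} (hper : ∀ t : ℤ, u (t + P) = u t) (i j : Fin P) :
    u (((i + j : Fin P) : ℕ) : ℤ) = u ((i : ℕ) + (j : ℕ)) := by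
  rw [Fin.val_add]
  push_cast
  exact per_emod hper _

/-- No weak cyclic alternation on integers. -/
def NoAlt (u : ℤ → ℝ) (P : ℕ) : Prop :=
  ∀ a b c d : ℤ, a < b → b < c → c < d → d < a + P →
    0 ≤ u a → u b ≤ 0 → 0 ≤ u c → u d ≤ 0 → False

lemma noAlt_of_Scplus {P : ℕ} [NeZero P] {u : ℤ → ℝ} (hper : ∀ t : ℤ, u (t + P) = u t)
    (h : Scplus (fun i : Fin P => u ((i : ℕ) : ℤ)) = 2) : NoAlt u P := by
  intro a b c d hab hbc hcd hda ha hb hc hd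
  have hP : (0 : ℤ) < P := by exact_mod_cast NeZero.pos P
  have m0 := Int.emod_nonneg a hP.ne'
  have m1 := Int.emod_lt_of_pos a hP
  let i : Fin P := ⟨(a % P).toNat, by omega⟩
  have key : ∀ x : ℤ, ∀ hx : a ≤ x ∧ x < a + P,
      u (((i + (⟨(x - a).toNat, by omega⟩ : Fin P) : Fin P) : ℕ) : ℤ) = u x := by
    intro x hx
    rw [per_fin_add hper]
    simp only [i]
    rw [Int.toNat_of_nonneg m0, Int.toNat_of_nonneg (by omega), ← per_emod hper x,
      ← per_emod hper (a % P + (x - a))]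
    congr 1
    rw [Int.emod_add_emod]
    congr 1
    ring
  have hi : u ((i : ℕ) : ℤ) = u a := by
    simp only [i]
    rw [Int.toNat_of_nonneg m0, per_emod hper]
  refine fin_noalt _ h i ⟨(b - a).toNat, by omega⟩ ⟨(c - a).toNat, by omega⟩
    ⟨(d - a).toNat, by omega⟩ ?_ ?_ ?_ ?_ ?_ ?_ ?_
  · rw [Fin.lt_def]; simp; omega
  · rw [Fin.lt_def]; simp; omega
  · rw [Fin.lt_def]; simp; omega
  · simpa only [hi] using ha
  · simpa only [key b (by omega)] using hb
  · simpa only [key c (by omega)] using hc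
  · simpa only [key d (by omega)] using hd

lemma noAlt_neg {P : ℕ} {u : ℤ → ℝ} (hper : ∀ t : ℤ, u (t + P) = u t) (h : NoAlt u P) :
    NoAlt (fun t => - u t) P := by
  intro a b c d hab hbc hcd hda ha hb hc hd
  simp only at ha hb hc hd
  refine h b c d (a + P) hbc hcd hda (by omega) (by linarith) (by linarith) (by linarith) ?_
  rw [hper]; linarith

/-- Pigeonhole. -/
lemma card_pairing {P : ℕ} [NeZero P] (c s : Fin P → ℝ) (hc : ∀ i, 0 < c i) (d : Fin P)
    (hs : ∀ j, 0 ≤ s j + s (j + d)) (hs' : 0 < ∑ j, s j) :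
    (Finset.univ.filter fun i => (Matrix.circulant c).mulVec s i < 0).card ≤
    (Finset.univ.filter fun i => 0 < (Matrix.circulant c).mulVec s i).card := by
  set H := (Matrix.circulant c).mulVec s with hH
  have hHv : ∀ i, H i = ∑ j, c (i - j) * s j := fun i => by
    simp [hH, Matrix.mulVec, dotProduct, Matrix.circulant_apply]
  have hsum : 0 < ∑ j, (s j + s (j + d)) := by
    rw [Finset.sum_add_distrib]
    have : ∑ j, s (j + d) = ∑ j, s j := Equiv.sum_comp (Equiv.addRight d) s
    rw [this]; linarith
  have hpair : ∀ i, 0 < H i + H (i + d) := by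
    intro i
    have e : H (i + d) = ∑ j, c (i - j) * s (j + d) := by
      rw [hHv, ← Equiv.sum_comp (Equiv.addRight d)]
      apply Finset.sum_congr rfl
      intro j _
      simp
    rw [e, hHv, ← Finset.sum_add_distrib]
    obtain ⟨j, _, hj⟩ := Finset.exists_lt_of_sum_lt
      (show ∑ j : Fin P, (0 : ℝ) < ∑ j, (s j + s (j + d)) by simpa using hsum)
    refine Finset.sum_pos' ?_ ⟨j, Finset.mem_univ _, ?_⟩
    · intro k _
      rw [← mul_add]
      exact mul_nonneg (hc _).le (hs k)
    · rw [← mul_add]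
      exact mul_pos (hc _) hj
  apply Finset.card_le_card_of_injOn (fun i => i + d)
  · intro i hi
    simp at hi ⊢
    have := hpair i
    linarith
  · intro i _ j _ hij
    simpa using hij

lemma sum_sign {n : ℕ} (v : Fin n → ℝ) :
    ∑ j, Real.sign (v j) = (Pp v : ℝ) - (Pn v : ℝ) := by
  unfold Pp Pn
  rw [Finset.card_filter, Finset.card_filter]
  push_cast
  rw [← Finset.sum_sub_distrib]
  apply Finset.sum_congr rfl
  intro j _
  rcases lt_trichotomy (v j) 0 with h | h | h
  · simp [Real.sign_of_neg h, h, h.not_gt]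
  · simp [h]
  · simp [Real.sign_of_pos h, h, h.not_gt]

lemma card_split {n : ℕ} (v : Fin n → ℝ) :
    Pp v + Pn v + (Finset.univ.filter fun i => v i = 0).card = n := by
  unfold Pp Pn
  rw [Finset.card_filter, Finset.card_filter, Finset.card_filter, ← Finset.sum_add_distrib,
    ← Finset.sum_add_distrib]
  have : ∀ j ∈ (Finset.univ : Finset (Fin n)), ((if 0 < v j then 1 else 0) +
      (if v j < 0 then 1 else 0) + if v j = 0 then 1 else 0) = 1 := by
    intro j _
    rcases lt_trichotomy (v j) 0 with h | h | h
    · simp [h, h.le, h.ne]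
    · simp [h]
    · simp [h, h.le, h.ne']
  rw [Finset.sum_congr rfl this]
  simp

/-- Structure of the sign pattern. -/
lemma exists_shift_int {P : ℕ} [NeZero P] {u : ℤ → ℝ} (hper : ∀ t : ℤ, u (t + P) = u t)
    (hna : NoAlt u P) (hlt : Pn (fun i : Fin P => u ((i : ℕ) : ℤ)) <
      Pp (fun i : Fin P => u ((i : ℕ) : ℤ))) :
    ∃ d : ℕ, ∀ x : ℤ, u x < 0 → 0 < u (x + d) ∧ 0 < u (x - d) := by
  have hP : (0 : ℤ) < P := by exact_mod_cast NeZero.pos P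
  by_cases hneg : ∃ x, u x < 0
  swap
  · exact ⟨0, fun x hx => absurd ⟨x, hx⟩ hneg⟩
  obtain ⟨x, hx⟩ := hneg
  have hpos : ∃ k : ℕ, 0 ≤ u (x - k) := by
    have : 0 < Pp (fun i : Fin P => u ((i : ℕ) : ℤ)) := by omega
    obtain ⟨y, hy⟩ := Finset.card_pos.1 this
    have hy := (Finset.mem_filter.1 hy).2
    have q0 := Int.emod_nonneg (x - y) hP.ne'
    refine ⟨((x - y) % P).toNat, ?_⟩
    rw [Int.toNat_of_nonneg q0]
    have e : x - (x - (y : ℕ)) % P = (y : ℕ) + ((x - (y : ℕ)) / P) * P := by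
      have := Int.emod_add_mul_ediv (x - (y : ℕ)) P
      linarith
    rw [e, per_mul hper]
    exact hy.le
  classical
  set k := Nat.find hpos with hk
  have hk1 : 0 ≤ u (x - k) := Nat.find_spec hpos
  have hk0 : k ≠ 0 := by
    intro h; rw [h] at hk1; simp at hk1; linarith
  have hk2 : u (x - (k - 1 : ℕ)) < 0 := by
    have := Nat.find_min hpos (show k - 1 < Nat.find hpos by omega)
    linarith
  obtain ⟨m, hm⟩ : ∃ m : ℤ, m = x - k + 1 := ⟨_, rfl⟩
  have hm0 : u m < 0 := by
    have : x - ((k - 1 : ℕ) : ℤ) = m := by omega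
    rwa [this] at hk2
  have hm1 : 0 ≤ u (m - 1 + P) := by
    rw [hper]
    have : m - 1 = x - k := by omega
    rwa [this]
  have hex : ∃ n : ℕ, 0 ≤ u (m + n) := ⟨P - 1, by
    have : m + ((P - 1 : ℕ) : ℤ) = m - 1 + P := by omega
    rwa [this]⟩
  obtain ⟨n, hn⟩ : ∃ n, n = Nat.find hex := ⟨_, rfl⟩
  have hn1 : 0 ≤ u (m + n) := hn ▸ Nat.find_spec hex
  have hn2 : ∀ i : ℕ, i < n → u (m + i) < 0 := by
    intro i hi
    have := Nat.find_min hex (hn ▸ hi)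
    linarith
  have hnP : n ≤ P - 1 := by
    rw [hn]
    apply Nat.find_min'
    have : m + ((P - 1 : ℕ) : ℤ) = m - 1 + P := by omega
    rwa [this]
  have hn0 : 0 < n := by
    rcases Nat.eq_zero_or_pos n with h | h
    · rw [h] at hn1; simp at hn1; linarith
    · exact h
  have hmid : ∀ j : ℤ, n < j → j < P - 1 → 0 < u (m + j) := by
    intro j h1 h2
    by_contra h3
    refine hna (m + n) (m + j) (m - 1 + P) (m + P) (by omega) (by omega) (by omega) (by omega)
      hn1 (by linarith) hm1 ?_
    rw [hper]; exact hm0.le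
  have hcard : n ≤ Pn (fun i : Fin P => u ((i : ℕ) : ℤ)) := by
    unfold Pn
    have q0 := fun i : ℕ => Int.emod_nonneg (m + i) hP.ne'
    have q1 := fun i : ℕ => Int.emod_lt_of_pos (m + i) hP
    have := Finset.card_le_card_of_injOn (s := Finset.range n)
      (t := Finset.univ.filter fun i : Fin P => u ((i : ℕ) : ℤ) < 0)
      (fun i => (⟨((m + i) % P).toNat, by have := q0 i; have := q1 i; omega⟩ : Fin P)) ?_ ?_
    · simpa using this
    · intro i hi
      simp only [Finset.coe_range, Set.mem_Iio] at hi
      simp only [Finset.coe_filter, Finset.mem_univ, true_and, Set.mem_setOf_eq]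
      rw [Int.toNat_of_nonneg (q0 i), per_emod hper]
      exact hn2 i hi
    · intro i hi j hj hij
      simp only [Finset.coe_range, Set.mem_Iio] at hi hj
      simp only [Fin.mk.injEq] at hij
      have h1 : (m + i) % P = (m + j) % P := by
        have := q0 i; have := q0 j; omega
      have h2 : (P : ℤ) ∣ (m + j) - (m + i) := Int.ModEq.dvd h1
      have h3 : (m + j) - (m + i) = (0 : ℤ) := by
        apply Int.eq_zero_of_abs_lt_dvd h2
        rw [abs_lt]; constructor <;> omega
      omega
  have hsplit := card_split (fun i : Fin P => u ((i : ℕ) : ℤ))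
  have hall : ∀ j : ℤ, n ≤ j → j < P → (P ≤ 2 * n + 1 ∨ (n < j ∧ j < P - 1)) → 0 < u (m + j) := by
    intro j h1 h2 h3
    by_cases h4 : n < j ∧ j < P - 1
    · exact hmid j h4.1 h4.2
    have h5 : P ≤ 2 * n + 1 := by tauto
    have h6 : 0 ≤ u (m + j) := by
      by_cases h7 : n < j
      · have : m + j = m - 1 + P := by omega
        rwa [this]
      · have : j = n := by omega
        rwa [this]
    have h8 : (Finset.univ.filter fun i : Fin P => u ((i : ℕ) : ℤ) = 0).card = 0 := by omega
    rw [Finset.card_eq_zero, Finset.filter_eq_empty_iff] at h8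
    have q0 := Int.emod_nonneg (m + j) hP.ne'
    have q1 := Int.emod_lt_of_pos (m + j) hP
    have h9 := h8 (Finset.mem_univ (⟨((m + j) % P).toNat, by omega⟩ : Fin P))
    simp only at h9
    rw [Int.toNat_of_nonneg q0, per_emod hper] at h9
    exact lt_of_le_of_ne h6 (Ne.symm h9)
  refine ⟨n + 1, fun z hz => ?_⟩
  have q0 := Int.emod_nonneg (z - m) hP.ne'
  have q1 := Int.emod_lt_of_pos (z - m) hP
  obtain ⟨y, hy⟩ : ∃ y, y = (z - m) % P := ⟨_, rfl⟩
  rw [← hy] at q0 q1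
  have hzy : ∀ t : ℤ, u (z + t) = u (m + (y + t)) := by
    intro t
    rw [← per_mul hper (m + (y + t)) ((z - m) / P)]
    congr 1
    have := Int.emod_add_mul_ediv (z - m) P
    rw [hy]
    linarith
  have hyn : y < n := by
    by_contra h
    have h1 := hzy 0
    simp only [add_zero] at h1
    rw [h1] at hz
    by_cases h2 : n < y ∧ y < P - 1
    · have := hmid y h2.1 h2.2
      linarith
    · by_cases h7 : n < y
      · have : m + y = m - 1 + P := by omega
        rw [this] at hz; linarith
      · have : y = n := by omega
        rw [this] at hz; linarith
  constructor
  · rw [hzy]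
    apply hall <;> push_cast <;> omega
  · rw [sub_eq_add_neg, hzy, ← hper, add_assoc]
    apply hall <;> push_cast <;> omega

lemma sign_nn {x : ℝ} (h : 0 ≤ x) : 0 ≤ Real.sign x := by
  rcases h.eq_or_lt with h | h
  · simp [← h]
  · simp [Real.sign_of_pos h]

lemma core {P : ℕ} [NeZero P] {u : ℤ → ℝ} (hper : ∀ t : ℤ, u (t + P) = u t)
    (hna : NoAlt u P) (c : Fin P → ℝ) (hc : ∀ i, 0 < c i)
    (hlt : Pn (fun i : Fin P => u ((i : ℕ) : ℤ)) < Pp (fun i : Fin P => u ((i : ℕ) : ℤ))) :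
    Pn ((Matrix.circulant c).mulVec fun i : Fin P => Real.sign (u ((i : ℕ) : ℤ))) ≤
    Pp ((Matrix.circulant c).mulVec fun i : Fin P => Real.sign (u ((i : ℕ) : ℤ))) := by
  obtain ⟨d, hd⟩ := exists_shift_int hper hna hlt
  refine card_pairing c _ hc (Fin.ofNat P d) ?_ ?_
  · intro j
    have e : u (((j + Fin.ofNat P d : Fin P) : ℕ) : ℤ) = u ((j : ℕ) + d) := by
      rw [per_fin_add hper, ← per_emod hper, ← per_emod hper ((j : ℕ) + d)]
      simp
    simp only [e]
    by_cases h1 : u ((j : ℕ) : ℤ) < 0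
    · have := (hd _ h1).1
      rw [Real.sign_of_neg h1, Real.sign_of_pos this]; simp
    by_cases h2 : u ((j : ℕ) + d) < 0
    · have := (hd _ h2).2
      rw [add_sub_cancel_right] at this
      rw [Real.sign_of_neg h2, Real.sign_of_pos this]; simp
    · exact add_nonneg (sign_nn (not_lt.1 h1)) (sign_nn (not_lt.1 h2))
  · rw [sum_sign (fun i : Fin P => u ((i : ℕ) : ℤ))]
    have : (Pn (fun i : Fin P => u ((i : ℕ) : ℤ)) : ℝ) < Pp (fun i : Fin P => u ((i : ℕ) : ℤ)) := by
      exact_mod_cast hlt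
    linarith

lemma Pp_neg {n : ℕ} (v : Fin n → ℝ) : Pp (-v) = Pn v := by
  unfold Pp Pn; simp

lemma Pn_neg {n : ℕ} (v : Fin n → ℝ) : Pn (-v) = Pp v := by
  unfold Pp Pn; simp

lemma pbar_pos {P : ℕ} [NeZero P] (g : ℤ → ℝ) (hg : Summable g) (t₁ : ℤ)
    (hsupp : Function.support g = {t : ℤ | t₁ ≤ t})
    (hpos : ∀ t : ℤ, t₁ ≤ t → 0 < g t) (i : Fin P) : 0 < pbar g P i := by
  have hP : (0 : ℤ) < P := by exact_mod_cast NeZero.pos P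
  unfold pbar
  have hinj : Function.Injective (fun k : ℤ => ((i : ℕ) : ℤ) + k * (P : ℤ)) := by
    intro a b h
    simp only [add_right_inj] at h
    exact mul_right_cancel₀ hP.ne' h
  have hs : Summable (fun k : ℤ => g (((i : ℕ) : ℤ) + k * (P : ℤ))) := hg.comp_injective hinj
  have hnn : ∀ t, 0 ≤ g t := by
    intro t
    by_cases h : t₁ ≤ t
    · exact (hpos t h).le
    · have : t ∉ Function.support g := by rw [hsupp]; exact h
      rw [Function.notMem_support.1 this]
  refine hs.tsum_pos (fun k => hnn _) |t₁| (hpos _ ?_)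
  have h1 := le_abs_self t₁
  have h2 := abs_nonneg t₁
  nlinarith

/-- Let `P > 1`, `g ∈ ℓ¹` with connected infinite support on which it is strictly
positive and strictly decreasing, `u ∈ ℓ∞(P)` with `S_c⁻(Δ_c u^P) = 2` and
`S_c⁺(u^P) = 2`, and `o^P = -H_{ḡ^P} sign(u^P)`.  If `P_p(u^P) = P_p(o^P)` and
`P_n(u^P) = P_n(o^P)`, then `P_p(u^P) = P_n(u^P)`; if moreover `u^P` has no zero
entries, then `P = 2 P_p(u^P)`. -/
theorem stmt10 (P : ℕ) (hP : 1 < P)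
    (g : ℤ → ℝ) (hg : Summable g) (t₁ : ℤ) (ht₁ : 0 ≤ t₁)
    (hsupp : Function.support g = {t : ℤ | t₁ ≤ t})
    (hpos : ∀ t : ℤ, t₁ ≤ t → 0 < g t)
    (hdec : ∀ t : ℤ, t₁ ≤ t → g (t + 1) < g t)
    (u : ℤ → ℝ) (hb : ∃ C : ℝ, ∀ t, |u t| ≤ C) (hper : ∀ t : ℤ, u (t + P) = u t)
    (uP : Fin P → ℝ) (huP : uP = fun i : Fin P => u ((i : ℕ) : ℤ))
    (hS1 : Scminus (cdiff uP) = 2) (hS2 : Scplus uP = 2)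
    (oP : Fin P → ℝ)
    (hoP : oP = -((Matrix.circulant (pbar g P)).mulVec fun i => Real.sign (uP i)))
    (hPp : Pp uP = Pp oP) (hPn : Pn uP = Pn oP) :
    Pp uP = Pn uP ∧ ((∀ i, uP i ≠ 0) → P = 2 * Pp uP) := by
  have : NeZero P := ⟨by omega⟩
  have hc := fun i : Fin P => pbar_pos g hg t₁ hsupp hpos i
  subst huP
  have hna := noAlt_of_Scplus hper hS2
  rw [hoP, Pp_neg] at hPp
  rw [hoP, Pn_neg] at hPn
  beta_reduce at hPp hPn
  have heq : Pp (fun i : Fin P => u ((i : ℕ) : ℤ)) = Pn (fun i : Fin P => u ((i : ℕ) : ℤ)) := by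
    rcases lt_trichotomy (Pn (fun i : Fin P => u ((i : ℕ) : ℤ)))
      (Pp (fun i : Fin P => u ((i : ℕ) : ℤ))) with h | h | h
    · have := core hper hna _ hc h
      omega
    · exact h.symm
    · have e : (fun i : Fin P => - u ((i : ℕ) : ℤ)) = -(fun i : Fin P => u ((i : ℕ) : ℤ)) := rfl
      have := core (u := fun t => - u t) (fun t => by simp only [hper]) (noAlt_neg hper hna) _ hc
        (by rw [e, Pp_neg, Pn_neg]; exact h)
      have e2 : (fun i : Fin P => Real.sign (- u ((i : ℕ) : ℤ))) =
          -(fun i : Fin P => Real.sign (u ((i : ℕ) : ℤ))) := by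
        funext i; simp [Real.sign_neg]
      rw [e2, Matrix.mulVec_neg, Pp_neg, Pn_neg] at this
      omega
  refine ⟨heq, fun hnz => ?_⟩
  have hsplit := card_split (fun i : Fin P => u ((i : ℕ) : ℤ))
  have h0 : (Finset.univ.filter fun i : Fin P => u ((i : ℕ) : ℤ) = 0).card = 0 := by
    rw [Finset.card_eq_zero, Finset.filter_eq_empty_iff]
    intro i _
    exact hnz i
  omega
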